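/- Let $d \geq 1$ be an integer and let $h \colon \mathbb{N} \to \mathbb{N}$ be a function such that $h(n) < \tfrac{1}{2d}\log_{16} n$ for all sufficiently large $n$. Let $A \in \mathrm{Mat}_d(\mathfrak{S})$ be a $d \times d$ matrix, and suppose there exists $n_0$ such that for every $n \geq n_0$ there exists $B_n \in \mathrm{Mat}_d(\mathfrak{S})$ with $A B_n \equiv E(u)^{h(n^2)}\,\mathrm{Id} \pmod{p^n}$ (congruence of matrices entrywise, $\mathrm{Id}$ the identity matrix). Then there exist an integer $s \geq 0$ and a matrix $B \in \mathrm{Mat}_d(\mathfrak{S})$ such that $A B = E(u)^s\,\mathrm{Id}$. -/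

import Mathlib

open PowerSeries in
theorem PowerSeries.C_dvd_iff_forall_dvd_coeff {R : Type*} [CommRing R] {a : R} {f : R⟦X⟧} :
    C a ∣ f ↔ ∀ n, a ∣ coeff n f := by
  constructor
  · rintro ⟨g, rfl⟩ n
    simp
  · intro h
    choose b hb using h
    refine ⟨mk b, ?_⟩
    ext n
    simp [hb n]

open PowerSeries in
theorem PowerSeries.prime_C {R : Type*} [CommRing R] [IsDomain R] {a : R} (ha : Prime a) :
    Prime (C a : R⟦X⟧) := by
  have hker : ∀ f : R⟦X⟧, C a ∣ f ↔ map (Ideal.Quotient.mk (Ideal.span {a})) f = 0 := by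
    intro f
    rw [C_dvd_iff_forall_dvd_coeff, PowerSeries.ext_iff]
    simp [Ideal.Quotient.eq_zero_iff_mem, Ideal.mem_span_singleton]
  have : (Ideal.span {a}).IsPrime := (Ideal.span_singleton_prime ha.ne_zero).2 ha
  refine ⟨fun h => ha.ne_zero (by simpa using congrArg constantCoeff h), fun h => ?_, ?_⟩
  · exact ha.not_isUnit (by simpa using h.map (constantCoeff (R := R)))
  · intro f g hfg
    simpa [hker] using hfg

open PowerSeries in
theorem not_isUnit_eisenstein {R : Type*} [CommRing R] {ϖ : R} {e : ℕ} {E w : R⟦X⟧}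
    (hϖ : Irreducible ϖ) (he : e ≠ 0)
    (hE : E = X ^ e + C ϖ * w) : ¬ IsUnit E := by
  rw [isUnit_iff_constantCoeff, hE]
  simp only [map_add, map_pow, constantCoeff_X, ne_eq, he, not_false_eq_true, zero_pow, map_mul,
    constantCoeff_C, zero_add]
  exact fun h => hϖ.not_isUnit (isUnit_of_mul_isUnit_left h)

section Eisenstein

open PowerSeries

variable {R : Type*} [CommRing R] [IsDomain R] [IsDiscreteValuationRing R]
  {ϖ : R} {e : ℕ} {E w : R⟦X⟧}

theorem not_C_dvd_eisenstein_pow (hϖ : Irreducible ϖ) (hE : E = X ^ e + C ϖ * w) (m : ℕ) :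
    ¬ C ϖ ∣ E ^ m := by
  intro h
  have h1 := (prime_C hϖ.prime).dvd_of_dvd_pow h
  rw [hE, dvd_add_left (dvd_mul_right _ _)] at h1
  have h2 := C_dvd_iff_forall_dvd_coeff.1 h1 e
  rw [coeff_X_pow_self] at h2
  exact hϖ.not_isUnit (isUnit_of_dvd_one h2)

theorem isUnit_or_mem_span_eisenstein_X (hϖ : Irreducible ϖ) (he : e ≠ 0)
    (hw : IsUnit w) (hE : E = X ^ e + C ϖ * w) (f : R⟦X⟧) :
    IsUnit f ∨ f ∈ Ideal.span {E, X} := by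
  rw [isUnit_iff_constantCoeff, or_iff_not_imp_left]
  intro hf
  have hX : (X : R⟦X⟧) ∈ Ideal.span {E, X} := Ideal.subset_span (by simp)
  have hEm : E ∈ Ideal.span {E, X} := Ideal.subset_span (by simp)
  have hC : C ϖ ∈ Ideal.span {E, X} := by
    rw [← Ideal.mul_unit_mem_iff_mem _ hw, show C ϖ * w = E - X ^ e by rw [hE]; ring]
    exact Ideal.sub_mem _ hEm (Ideal.pow_mem_of_mem _ hX _ (Nat.pos_of_ne_zero he))
  have hdvd : ϖ ∣ constantCoeff f := by
    rwa [← Ideal.mem_span_singleton, ← hϖ.maximalIdeal_eq, IsLocalRing.mem_maximalIdeal]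
  obtain ⟨a, ha⟩ := hdvd
  have hXf : X ∣ f - C (constantCoeff f) := by simp [X_dvd_iff]
  obtain ⟨g, hg⟩ := hXf
  rw [show f = C ϖ * C a + X * g by rw [← hg, ha, map_mul]; ring]
  exact Ideal.add_mem _ (Ideal.mul_mem_right _ _ hC) (Ideal.mul_mem_right _ _ hX)

theorem X_pow_mem_span_eisenstein (hϖ : Irreducible ϖ) (he : e ≠ 0) (hw : IsUnit w)
    (hE : E = X ^ e + C ϖ * w) (j : ℕ) (f : R⟦X⟧) (hf : f ∉ Ideal.span {E, X ^ j}) :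
    X ^ j ∈ Ideal.span {E, f} := by
  induction j generalizing f with
  | zero =>
    refine absurd ?_ hf
    rw [(Ideal.eq_top_iff_one _).2 (Ideal.subset_span (by simp))]
    trivial
  | succ j ih =>
    rcases isUnit_or_mem_span_eisenstein_X hϖ he hw hE f with hu | hm
    · rw [Ideal.eq_top_of_isUnit_mem _ (Ideal.subset_span (by simp)) hu]
      trivial
    · obtain ⟨a, g, rfl⟩ := Ideal.mem_span_pair.1 hm
      have hg : g ∉ Ideal.span {E, X ^ j} := by
        intro hg
        obtain ⟨b, c, rfl⟩ := Ideal.mem_span_pair.1 hg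
        exact hf (Ideal.mem_span_pair.2 ⟨a + b * X, c, by ring⟩)
      obtain ⟨x, y, hxy⟩ := Ideal.mem_span_pair.1 (ih g hg)
      refine Ideal.mem_span_pair.2 ⟨x * X - y * a, y, ?_⟩
      rw [pow_succ, ← hxy]
      ring

theorem exists_notMem_span_eisenstein_X_pow (f : R⟦X⟧) (hf : ¬ E ∣ f) :
    ∃ j : ℕ, f ∉ Ideal.span {E, X ^ j} := by
  by_contra! h
  have hX : Ideal.span {(X : R⟦X⟧)} ≠ ⊤ := by
    rw [Ne, Ideal.span_singleton_eq_top]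
    exact X_prime.not_isUnit
  have hinf := Ideal.iInf_pow_smul_eq_bot_of_isLocalRing
    (M := R⟦X⟧ ⧸ Ideal.span {E}) _ hX
  have hmem : Ideal.Quotient.mk (Ideal.span {E}) f ∈
      (⨅ i : ℕ, Ideal.span {(X : R⟦X⟧)} ^ i • ⊤ : Submodule R⟦X⟧ (R⟦X⟧ ⧸ Ideal.span {E})) := by
    refine (Submodule.mem_iInf _).2 fun i => ?_
    obtain ⟨a, b, rfl⟩ := Ideal.mem_span_pair.1 (h i)
    have : Ideal.Quotient.mk (Ideal.span {E}) (a * E + b * X ^ i) =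
        (X ^ i : R⟦X⟧) • Ideal.Quotient.mk (Ideal.span {E}) b := by
      change _ = Ideal.Quotient.mk (Ideal.span {E}) (X ^ i * b)
      rw [Ideal.Quotient.eq, Ideal.mem_span_singleton]
      exact ⟨a, by ring⟩
    rw [this]
    exact Submodule.smul_mem_smul (Ideal.pow_mem_pow (Ideal.mem_span_singleton_self _) i) trivial
  rw [hinf, Submodule.mem_bot, Ideal.Quotient.eq_zero_iff_mem, Ideal.mem_span_singleton] at hmem
  exact hf hmem

theorem exists_C_pow_mem_span_eisenstein (hϖ : Irreducible ϖ) (he : e ≠ 0) (hw : IsUnit w)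
    (hE : E = X ^ e + C ϖ * w) (f : R⟦X⟧) (hf : ¬ E ∣ f) :
    ∃ c : ℕ, C ϖ ^ c ∈ Ideal.span {E, f} := by
  obtain ⟨j, hj⟩ := exists_notMem_span_eisenstein_X_pow f hf
  have hX := X_pow_mem_span_eisenstein hϖ he hw hE j f hj
  refine ⟨j, ?_⟩
  rw [← Ideal.mul_unit_mem_iff_mem _ (hw.pow j), ← mul_pow,
    show C ϖ * w = E - X ^ e by rw [hE]; ring]
  have hsub : (E - X ^ e) ^ j - (-X ^ e) ^ j ∈ Ideal.span {E, f} := by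
    refine Ideal.mem_of_dvd _ (sub_dvd_pow_sub_pow _ _ j) ?_
    rw [sub_neg_eq_add, sub_add_cancel]
    exact Ideal.subset_span (by simp)
  rw [← sub_add_cancel ((E - X ^ e) ^ j) ((-X ^ e) ^ j)]
  refine Ideal.add_mem _ hsub ?_
  rw [neg_pow, pow_right_comm]
  exact Ideal.mul_mem_left _ _ (Ideal.pow_mem_of_mem _ hX _ (Nat.pos_of_ne_zero he))

/-- If `f` is prime to `E` but divides small powers of `E` modulo large powers of the
uniformizer, then `f` is a unit. -/
theorem isUnit_of_dvd_eisenstein_pow_mod (hϖ : Irreducible ϖ) (he : e ≠ 0) (hw : IsUnit w)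
    (hE : E = X ^ e + C ϖ * w) (f : R⟦X⟧) (hf : ¬ E ∣ f)
    (H : ∀ c : ℕ, ∃ (m n : ℕ) (g : R⟦X⟧), c * m < n ∧ C ϖ ^ n ∣ f * g - E ^ m) :
    IsUnit f := by
  have hp := prime_C hϖ.prime
  obtain ⟨c, hc⟩ := exists_C_pow_mem_span_eisenstein hϖ he hw hE f hf
  obtain ⟨x, y, hxy⟩ := Ideal.mem_span_pair.1 hc
  obtain ⟨m, n, g, hmn, t, ht⟩ := H c
  obtain ⟨l, rfl⟩ := Nat.exists_eq_add_of_lt hmn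
  have hunit : IsUnit (1 + x ^ m * C ϖ ^ (l + 1) * t) := by
    rw [isUnit_iff_constantCoeff]
    simp only [map_add, map_mul, map_pow, map_one, constantCoeff_C]
    rw [← sub_neg_eq_add]
    refine IsLocalRing.isUnit_one_sub_self_of_mem_nonunits _ ?_
    rw [mem_nonunits_iff, show -(constantCoeff x ^ m * ϖ ^ (l + 1) * constantCoeff t) =
      ϖ * -(constantCoeff x ^ m * ϖ ^ l * constantCoeff t) by ring]
    exact fun h => hϖ.not_isUnit (isUnit_of_mul_isUnit_left h)
  have hpow : f ∣ C ϖ ^ (c * m) - (x * E) ^ m := by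
    rw [pow_mul]
    refine dvd_trans ⟨y, ?_⟩ (sub_dvd_pow_sub_pow _ _ m)
    rw [← hxy]
    ring
  have hdvd : f ∣ C ϖ ^ (c * m) := by
    rw [← hunit.dvd_mul_right]
    have : C ϖ ^ (c * m) * (1 + x ^ m * C ϖ ^ (l + 1) * t) =
        (C ϖ ^ (c * m) - (x * E) ^ m) + f * (x ^ m * g) := by
      linear_combination (-x ^ m) * ht
    rw [this]
    exact dvd_add hpow (dvd_mul_right _ _)
  obtain ⟨i, -, hi⟩ := (dvd_prime_pow hp _).1 hdvd
  rcases i with _ | i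
  · rw [pow_zero] at hi
    exact hi.symm.isUnit isUnit_one
  · exfalso
    have h1 : C ϖ ∣ f := (dvd_pow_self _ i.succ_ne_zero).trans hi.symm.dvd
    refine not_C_dvd_eisenstein_pow hϖ hE m ?_
    rw [show E ^ m = f * g - C ϖ ^ (c * m + l + 1) * t by rw [← ht]; ring]
    exact dvd_sub (h1.mul_right g) (Dvd.dvd.mul_right (dvd_pow_self _ (by omega)) t)

theorem exists_dvd_eisenstein_pow (hϖ : Irreducible ϖ) (he : e ≠ 0) (hw : IsUnit w)
    (hE : E = X ^ e + C ϖ * w) (f : R⟦X⟧)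
    (H : ∀ c : ℕ, ∃ (m n : ℕ) (g : R⟦X⟧), c * m < n ∧ C ϖ ^ n ∣ f * g - E ^ m) :
    ∃ s : ℕ, f ∣ E ^ s := by
  have hf : f ≠ 0 := by
    rintro rfl
    obtain ⟨m, n, g, hmn, hd⟩ := H 0
    rw [zero_mul, zero_sub, dvd_neg] at hd
    exact not_C_dvd_eisenstein_pow hϖ hE m ((dvd_pow_self _ (by omega)).trans hd)
  obtain ⟨f', hff', hf'⟩ := (FiniteMultiplicity.of_not_isUnit
    (not_isUnit_eisenstein hϖ he hE) hf).exists_eq_pow_mul_and_not_dvd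
  have hu : IsUnit f' := by
    refine isUnit_of_dvd_eisenstein_pow_mod hϖ he hw hE f' hf' fun c => ?_
    obtain ⟨m, n, g, hmn, hd⟩ := H c
    refine ⟨m, n, E ^ multiplicity E f * g, hmn, ?_⟩
    rwa [show f' * (E ^ multiplicity E f * g) = f * g by
      conv_rhs => rw [hff']
      ring]
  refine ⟨multiplicity E f, ?_⟩
  conv_lhs => rw [hff']
  rw [hu.mul_right_dvd]

end Eisenstein

theorem Matrix.exists_mul_eq_smul_one_of_det_dvd {ι R : Type*} [Fintype ι] [DecidableEq ι]
    [CommRing R] (A : Matrix ι ι R) {a : R} (h : A.det ∣ a) :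
    ∃ B : Matrix ι ι R, A * B = a • (1 : Matrix ι ι R) := by
  obtain ⟨b, rfl⟩ := h
  exact ⟨b • A.adjugate, by rw [Matrix.mul_smul, Matrix.mul_adjugate, smul_smul, mul_comm]⟩

theorem Matrix.dvd_det_mul_det_sub_pow {ι R : Type*} [Fintype ι] [DecidableEq ι]
    [CommRing R] (A B : Matrix ι ι R) (q a : R)
    (h : ∀ i j, q ∣ (A * B - a • (1 : Matrix ι ι R)) i j) :
    q ∣ A.det * B.det - a ^ Fintype.card ι := by
  have hmap : (A * B).map (Ideal.Quotient.mk (Ideal.span {q})) =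
      (a • (1 : Matrix ι ι R)).map (Ideal.Quotient.mk (Ideal.span {q})) := by
    ext i j
    rw [Matrix.map_apply, Matrix.map_apply, Ideal.Quotient.eq, Ideal.mem_span_singleton]
    exact h i j
  have hdet := congrArg Matrix.det hmap
  rw [← RingHom.mapMatrix_apply, ← RingHom.mapMatrix_apply, ← RingHom.map_det,
    ← RingHom.map_det, Ideal.Quotient.eq, Ideal.mem_span_singleton] at hdet
  simpa using hdet

theorem exists_eisenstein_eq_X_pow_add_mul {R : Type*} [CommRing R] [IsDomain R]
    [IsDiscreteValuationRing R] {ϖ : R} (hϖ : Irreducible ϖ) (E : Polynomial R)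
    (hmon : E.Monic) (hdeg : E.natDegree ≠ 0) (heis : ∀ i < E.natDegree, ϖ ∣ E.coeff i)
    (hcon : ¬ ϖ ^ 2 ∣ E.coeff 0) :
    ∃ w : PowerSeries R, IsUnit w ∧
      (E : PowerSeries R) = PowerSeries.X ^ E.natDegree + PowerSeries.C ϖ * w := by
  have hd : PowerSeries.C ϖ ∣ (E : PowerSeries R) - PowerSeries.X ^ E.natDegree := by
    rw [PowerSeries.C_dvd_iff_forall_dvd_coeff]
    intro n
    rw [map_sub, Polynomial.coeff_coe, PowerSeries.coeff_X_pow]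
    rcases lt_trichotomy n E.natDegree with hn | rfl | hn
    · simpa [hn.ne] using heis n hn
    · simp [hmon.coeff_natDegree]
    · simp [hn.ne', Polynomial.coeff_eq_zero_of_natDegree_lt hn]
  obtain ⟨w, hw⟩ := hd
  refine ⟨w, ?_, by rw [← hw]; ring⟩
  rw [PowerSeries.isUnit_iff_constantCoeff]
  by_contra hu
  rw [← mem_nonunits_iff, ← IsLocalRing.mem_maximalIdeal, hϖ.maximalIdeal_eq,
    Ideal.mem_span_singleton] at hu
  apply hcon
  have h0 := congrArg PowerSeries.constantCoeff hw
  rw [map_sub, map_pow, PowerSeries.constantCoeff_X, zero_pow hdeg, sub_zero, map_mul,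
    PowerSeries.constantCoeff_C, Polynomial.constantCoeff_coe] at h0
  rw [h0, sq]
  exact mul_dvd_mul_left ϖ hu

theorem exists_mul_lt_of_lt_logb {d : ℕ} (hd : 1 ≤ d) (h : ℕ → ℕ)
    (hh : ∃ N, ∀ n ≥ N, (h n : ℝ) < (1 / (2 * (d : ℝ))) * Real.logb 16 n) (n₀ c : ℕ) :
    ∃ n ≥ n₀, c * (h (n ^ 2) * d) < n := by
  obtain ⟨N, hN⟩ := hh
  set t := n₀ + N + c + 1 with ht
  have hle : t ≤ 16 ^ t := (Nat.lt_pow_self (by norm_num)).le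
  have hsq : t * t < 16 ^ t := by
    calc t * t < 4 ^ t * 4 ^ t := by
          have := Nat.lt_pow_self (n := t) (a := 4) (by norm_num)
          gcongr
      _ = 16 ^ t := by rw [← mul_pow]; norm_num
  refine ⟨16 ^ t, by omega, lt_of_le_of_lt (Nat.mul_le_mul (by omega) ?_) hsq⟩
  have hb := hN ((16 ^ t) ^ 2) (by nlinarith)
  have hlog : Real.logb 16 (((16 ^ t) ^ 2 : ℕ) : ℝ) = 2 * t := by
    push_cast
    rw [Real.logb_pow, Real.logb_pow, Real.logb_self_eq_one (by norm_num)]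
    simp
  have hd' : (0 : ℝ) < d := by exact_mod_cast hd
  rw [hlog, show 1 / (2 * (d : ℝ)) * (2 * t) = t / d by field_simp, lt_div_iff₀ hd'] at hb
  exact_mod_cast hb.le


/-- Let `𝔖 = W(k)⟦u⟧` and let `E` be a monic Eisenstein polynomial of degree
`e ≥ 1`. Let `d ≥ 1` and `h : ℕ → ℕ` with `h n < (1/(2d)) log₁₆ n` for all sufficiently large
`n`. Let `A` be a `d × d` matrix over `𝔖` such that for some `n₀` and all `n ≥ n₀` there is a
matrix `Bₙ` with `A Bₙ ≡ E(u)^(h(n²)) · Id (mod pⁿ)` entrywise. Then there are `s ≥ 0` and a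
matrix `B` with `A B = E(u)^s · Id`. -/
theorem stmt3 {p : ℕ} [Fact p.Prime] {k : Type*} [Field k] [CharP k p] [PerfectRing k p]
    (e : ℕ) (he : 1 ≤ e) (E : Polynomial (WittVector p k))
    (hmon : E.Monic) (hdeg : E.natDegree = e)
    (heis : ∀ i < e, (p : WittVector p k) ∣ E.coeff i)
    (hcon : ¬ ((p : WittVector p k) ^ 2 ∣ E.coeff 0))
    (d : ℕ) (hd : 1 ≤ d) (h : ℕ → ℕ)
    (hh : ∃ N, ∀ n ≥ N, (h n : ℝ) < (1 / (2 * (d : ℝ))) * Real.logb 16 n)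
    (A : Matrix (Fin d) (Fin d) (PowerSeries (WittVector p k)))
    (hA : ∃ n₀, ∀ n ≥ n₀, ∃ B : Matrix (Fin d) (Fin d) (PowerSeries (WittVector p k)),
      ∀ i j, (p : PowerSeries (WittVector p k)) ^ n ∣
        (A * B - (E : PowerSeries (WittVector p k)) ^ (h (n ^ 2)) •
          (1 : Matrix (Fin d) (Fin d) (PowerSeries (WittVector p k)))) i j) :
    ∃ (s : ℕ) (B : Matrix (Fin d) (Fin d) (PowerSeries (WittVector p k))),
      A * B = (E : PowerSeries (WittVector p k)) ^ s •
        (1 : Matrix (Fin d) (Fin d) (PowerSeries (WittVector p k))) := by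
  have hϖ : Irreducible (p : WittVector p k) := WittVector.irreducible p
  have he0 : E.natDegree ≠ 0 := by omega
  obtain ⟨w, hw, hE⟩ := exists_eisenstein_eq_X_pow_add_mul hϖ E hmon he0 (hdeg ▸ heis) hcon
  obtain ⟨n₀, hA⟩ := hA
  have key : ∃ s : ℕ, A.det ∣ (E : PowerSeries (WittVector p k)) ^ s := by
    refine exists_dvd_eisenstein_pow hϖ he0 hw hE A.det fun c => ?_
    obtain ⟨n, hn, hlt⟩ := exists_mul_lt_of_lt_logb hd h hh n₀ c
    obtain ⟨B, hB⟩ := hA n hn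
    refine ⟨h (n ^ 2) * d, n, B.det, hlt, ?_⟩
    simpa [pow_mul] using Matrix.dvd_det_mul_det_sub_pow A B _ _ hB
  obtain ⟨s, hs⟩ := key
  exact ⟨s, A.exists_mul_eq_smul_one_of_det_dvd hs⟩
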